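/- Let Ω be a finite set, F₁, F₂ ∈ D(Ω), and let G₀ = F₁ ⊎ F₂, G₁, …, G_n be a sequence of multisets of subsets of Ω obtained by successively applying properly intersecting elimination operations. Fix i₀ ∈ {1, …, n} and suppose every operation producing G₁, …, G_{i₀} is of Type 1 or Type 2. Then for every i ∈ {1, …, i₀} and every maximal member Z of G_i, Z contains some member of G₀; moreover, if Z ∉ G₀, then Z contains a member of F₁ and a member of F₂. -/

import Mathlib

section Pieo

variable {Ω : Type} [DecidableEq Ω]

/-- Two finite sets `X, Y` are properly intersecting if `X ∩ Y`, `X \ Y`,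
`Y \ X` are all nonempty. -/
def ProperlyIntersecting (X Y : Finset Ω) : Prop :=
  (X ∩ Y).Nonempty ∧ (X \ Y).Nonempty ∧ (Y \ X).Nonempty

/-- The three types of properly intersecting elimination operations. -/
inductive PieoType : Type
  | one : PieoType
  | two : PieoType
  | three : PieoType
deriving DecidableEq

/-- `pieoStep τ G G'` : `G'` is obtained from the multiset `G` by a properly
intersecting elimination operation (PIEO) of type `τ` on some properly
intersecting pair `X, Y` of members of `G`:  Type 1 replaces `X, Y` by `X ∪ Y`
and `X ∩ Y`, Type 2 replaces them by `X ∪ Y` only, Type 3 by `X ∩ Y` only. -/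
def pieoStep (τ : PieoType) (G G' : Multiset (Finset Ω)) : Prop :=
  ∃ X Y H, ProperlyIntersecting X Y ∧ G = X ::ₘ Y ::ₘ H ∧
    G' = (match τ with
      | PieoType.one => (X ∪ Y) ::ₘ (X ∩ Y) ::ₘ H
      | PieoType.two => (X ∪ Y) ::ₘ H
      | PieoType.three => (X ∩ Y) ::ₘ H)

/-- `G(v)`: the number of members of the multiset `G` (with multiplicity)
containing `v`. -/
def countMem (G : Multiset (Finset Ω)) (v : Ω) : ℕ :=
  Multiset.countP (fun X => v ∈ X) G

/-- A member `Z` of the multiset `G` is maximal if no member of `G` properly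
contains it. -/
def IsMaxMember (G : Multiset (Finset Ω)) (Z : Finset Ω) : Prop :=
  ∀ W ∈ G, ¬ Z ⊂ W

/-- A multiset of sets is laminar if it contains no properly intersecting pair. -/
def LaminarM (G : Multiset (Finset Ω)) : Prop :=
  ∀ X ∈ G, ∀ Y ∈ G, ¬ ProperlyIntersecting X Y

/-- The family of maximal members of `G` (each listed once). -/
def maxMembers (G : Multiset (Finset Ω)) : Multiset (Finset Ω) :=
  (G.filter fun Z => ∀ W ∈ G, ¬ Z ⊂ W).dedup

/-- The union `∪F` of all members of the multiset `F`. -/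
def msUnion (G : Multiset (Finset Ω)) : Finset Ω :=
  G.sup

/-- The partial order on families of disjoint subsets: `F ≤ G` iff every member
of `F` is contained in some member of `G`. -/
def famLE (F G : Multiset (Finset Ω)) : Prop :=
  ∀ X ∈ F, ∃ Y ∈ G, X ⊆ Y

end Pieo

theorem countMem_le_one_of_pairwise_disjoint {Ω : Type} [DecidableEq Ω]
    {F : Multiset (Finset Ω)} (hF : F.Pairwise fun X Y => Disjoint X Y) (v : Ω) :
    countMem F v ≤ 1 := by
  obtain ⟨l, rfl, hl⟩ := hF
  induction l with
  | nil => simp [countMem]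
  | cons X l ih =>
    rw [List.pairwise_cons] at hl
    have ih := ih hl.2
    simp only [countMem, Multiset.coe_countP, List.countP_cons, decide_eq_true_eq] at ih ⊢
    split_ifs with hv
    · have : List.countP (fun Y => decide (v ∈ Y)) l = 0 :=
        List.countP_eq_zero.2 fun Y hY hvY =>
          Finset.disjoint_left.1 (hl.1 Y hY) hv (of_decide_eq_true hvY)
      omega
    · omega

theorem eq_of_mem_of_countMem_le_one {Ω : Type} [DecidableEq Ω]
    {F : Multiset (Finset Ω)} {v : Ω} (hF : countMem F v ≤ 1) {X Y : Finset Ω}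
    (hX : X ∈ F) (hY : Y ∈ F) (hvX : v ∈ X) (hvY : v ∈ Y) : X = Y := by
  by_contra hne
  obtain ⟨H, rfl⟩ := Multiset.exists_cons_of_mem hX
  obtain ⟨K, rfl⟩ := Multiset.exists_cons_of_mem
    ((Multiset.mem_cons.1 hY).resolve_left (Ne.symm hne))
  simp [countMem, hvX, hvY] at hF

theorem countMem_le_of_pieoStep {Ω : Type} [DecidableEq Ω] {τ : PieoType}
    {G G' : Multiset (Finset Ω)} (h : pieoStep τ G G') (v : Ω) :
    countMem G' v ≤ countMem G v := by
  obtain ⟨X, Y, H, -, rfl, rfl⟩ := h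
  cases τ <;> by_cases hX : v ∈ X <;> by_cases hY : v ∈ Y <;>
    simp [countMem, hX, hY]

/-- If every point is covered at most twice, two intersecting members of which neither contains
the other are maximal. -/
theorem ProperlyIntersecting.isMaxMember {Ω : Type} [DecidableEq Ω] {X Y : Finset Ω}
    {H : Multiset (Finset Ω)} (h : ProperlyIntersecting X Y)
    (hc : ∀ v, countMem (X ::ₘ Y ::ₘ H) v ≤ 2) :
    IsMaxMember (X ::ₘ Y ::ₘ H) X ∧ IsMaxMember (X ::ₘ Y ::ₘ H) Y := by
  obtain ⟨⟨v, hv⟩, hXY, hYX⟩ := h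
  rw [Finset.mem_inter] at hv
  have hH : ∀ W ∈ H, v ∉ W := by
    intro W hW hvW
    obtain ⟨K, rfl⟩ := Multiset.exists_cons_of_mem hW
    have := hc v
    simp [countMem, hv.1, hv.2, hvW] at this
  constructor <;> intro W hW hlt <;> simp only [Multiset.mem_cons] at hW <;>
    rcases hW with rfl | rfl | hW
  · exact hlt.ne rfl
  · exact (Finset.sdiff_nonempty.1 hXY) hlt.1
  · exact hH W hW (hlt.1 hv.1)
  · exact (Finset.sdiff_nonempty.1 hYX) hlt.1
  · exact hlt.ne rfl
  · exact hH W hW (hlt.1 hv.2)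

/-- After a step of Type 1 or 2, a maximal member is either an old maximal member or the new
union. -/
theorem eq_union_or_isMaxMember_of_pieoStep {Ω : Type} [DecidableEq Ω] {τ : PieoType}
    {X Y Z : Finset Ω} {G' H : Multiset (Finset Ω)}
    (hXY : ProperlyIntersecting X Y)
    (hG' : G' = (match τ with
      | PieoType.one => (X ∪ Y) ::ₘ (X ∩ Y) ::ₘ H
      | PieoType.two => (X ∪ Y) ::ₘ H
      | PieoType.three => (X ∩ Y) ::ₘ H))
    (hτ : τ ≠ PieoType.three) (hZ : Z ∈ G') (hmax : IsMaxMember G' Z) :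
    Z = X ∪ Y ∨ (Z ∈ H ∧ IsMaxMember (X ::ₘ Y ::ₘ H) Z) := by
  have hU : X ∪ Y ∈ G' := by
    cases τ
    · simp [hG']
    · simp [hG']
    · exact absurd rfl hτ
  have hsub : ∀ W ∈ H, W ∈ G' := by
    intro W hW
    cases τ <;> simp_all
  have hmem : Z = X ∪ Y ∨ Z = X ∩ Y ∨ Z ∈ H := by cases τ <;> simp_all <;> tauto
  rcases hmem with rfl | rfl | hZH
  · exact Or.inl rfl
  · refine absurd ⟨Finset.inter_subset_union, fun hle => ?_⟩ (hmax _ hU)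
    exact Finset.sdiff_nonempty.1 hXY.2.1
      ((Finset.subset_union_left.trans hle).trans Finset.inter_subset_right)
  · refine Or.inr ⟨hZH, fun W hW hlt => ?_⟩
    simp only [Multiset.mem_cons] at hW
    rcases hW with rfl | rfl | hW
    · exact hmax _ hU (hlt.trans_subset Finset.subset_union_left)
    · exact hmax _ hU (hlt.trans_subset Finset.subset_union_right)
    · exact hmax _ (hsub W hW) hlt

/-- **Proposition.**  Along a sequence of PIEOs starting from `G₀ = F₁ ⊎ F₂`
with `F₁, F₂ ∈ D(Ω)`, in which the operations producing `G₁, …, G_{i₀}` are of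
Type 1 or Type 2: for every `i ∈ [i₀]` and every maximal member `Z` of `G_i`,
`Z` contains a member of `G₀`; moreover, if `Z ∉ G₀`, then `Z` contains a
member of `F₁` and a member of `F₂`. -/
theorem pieo_maximal_contains_original
    {Ω : Type} [Fintype Ω] [DecidableEq Ω]
    (F₁ F₂ : Multiset (Finset Ω))
    (hF₁ : F₁.Pairwise fun X Y => Disjoint X Y)
    (hF₂ : F₂.Pairwise fun X Y => Disjoint X Y)
    (n : ℕ) (G : Fin (n + 1) → Multiset (Finset Ω))
    (τ : Fin n → PieoType)
    (hG0 : G 0 = F₁ + F₂)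
    (hstep : ∀ i : Fin n, pieoStep (τ i) (G i.castSucc) (G i.succ))
    (i₀ : ℕ) (hi₀ : i₀ ≤ n)
    (htype : ∀ i : Fin n, (i : ℕ) < i₀ → τ i ≠ PieoType.three) :
    ∀ i : Fin (n + 1), 1 ≤ (i : ℕ) → (i : ℕ) ≤ i₀ →
      ∀ Z ∈ G i, IsMaxMember (G i) Z →
        (∃ W ∈ G 0, W ⊆ Z) ∧
        (Z ∉ G 0 → (∃ W₁ ∈ F₁, W₁ ⊆ Z) ∧ (∃ W₂ ∈ F₂, W₂ ⊆ Z)) := by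
  have key : ∀ k : ℕ, ∀ hk : k < n + 1, k ≤ i₀ →
      (∀ v, countMem (G ⟨k, hk⟩) v ≤ 2) ∧
      ∀ Z ∈ G ⟨k, hk⟩, IsMaxMember (G ⟨k, hk⟩) Z →
        (Z ∈ F₁ ∨ Z ∈ F₂) ∨ (∃ W₁ ∈ F₁, W₁ ⊆ Z) ∧ (∃ W₂ ∈ F₂, W₂ ⊆ Z) := by
    intro k
    induction k with
    | zero =>
      intro hk _
      have h0 : G ⟨0, hk⟩ = F₁ + F₂ := hG0
      rw [h0]
      refine ⟨fun v => ?_, fun Z hZ _ => Or.inl (Multiset.mem_add.1 hZ)⟩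
      have h₁ := countMem_le_one_of_pairwise_disjoint hF₁ v
      have h₂ := countMem_le_one_of_pairwise_disjoint hF₂ v
      simp only [countMem, Multiset.countP_add] at h₁ h₂ ⊢
      omega
    | succ k ih =>
      intro hk hki
      obtain ⟨hc, hZ⟩ := ih (by omega) (by omega)
      have hs : pieoStep (τ ⟨k, by omega⟩) (G ⟨k, by omega⟩) (G ⟨k + 1, hk⟩) :=
        hstep ⟨k, by omega⟩
      have hτ := htype ⟨k, by omega⟩ (by simpa using hki)
      refine ⟨fun v => (countMem_le_of_pieoStep hs v).trans (hc v), fun Z hZG hmax => ?_⟩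
      obtain ⟨X, Y, H, hXY, hG, hG'⟩ := hs
      rw [hG] at hc hZ
      rcases eq_union_or_isMaxMember_of_pieoStep hXY hG' hτ hZG hmax with rfl | ⟨hZH, hZmax⟩
      · right
        obtain ⟨hXmax, hYmax⟩ := hXY.isMaxMember hc
        obtain ⟨⟨v, hv⟩, hd, -⟩ := hXY
        rw [Finset.mem_inter] at hv
        have hne : X ≠ Y := by
          rintro rfl
          simp at hd
        have hX : X ⊆ X ∪ Y := Finset.subset_union_left
        have hY : Y ⊆ X ∪ Y := Finset.subset_union_right
        rcases hZ X (by simp) hXmax with hX' | ⟨⟨A, hA, hAX⟩, B, hB, hBX⟩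
        · rcases hZ Y (by simp) hYmax with hY' | ⟨⟨A, hA, hAY⟩, B, hB, hBY⟩
          · rcases hX' with hX' | hX' <;> rcases hY' with hY' | hY'
            · exact absurd (eq_of_mem_of_countMem_le_one
                (countMem_le_one_of_pairwise_disjoint hF₁ v) hX' hY' hv.1 hv.2) hne
            · exact ⟨⟨X, hX', hX⟩, Y, hY', hY⟩
            · exact ⟨⟨Y, hY', hY⟩, X, hX', hX⟩
            · exact absurd (eq_of_mem_of_countMem_le_one
                (countMem_le_one_of_pairwise_disjoint hF₂ v) hX' hY' hv.1 hv.2) hne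
          · exact ⟨⟨A, hA, hAY.trans hY⟩, B, hB, hBY.trans hY⟩
        · exact ⟨⟨A, hA, hAX.trans hX⟩, B, hB, hBX.trans hX⟩
      · exact hZ Z (by simp [hZH]) hZmax
  intro i _ hi Z hZ hmax
  rw [hG0]
  rcases (key i i.isLt hi).2 Z hZ hmax with h | ⟨⟨A, hA, hAZ⟩, hB⟩
  · have h0 : Z ∈ F₁ + F₂ := Multiset.mem_add.2 h
    exact ⟨⟨Z, h0, subset_rfl⟩, fun hn => absurd h0 hn⟩
  · exact ⟨⟨A, Multiset.mem_add.2 (Or.inl hA), hAZ⟩, fun _ => ⟨⟨A, hA, hAZ⟩, hB⟩⟩
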